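/- arXiv:1310.0719 — 5 statements merged into one kernel-verified Lean document; each statement's English description precedes it below -/
import Mathlib

section
/- Let Γ ⊆ ℝⁿ be an open set invariant under permutations of the coordinates, and let g : Γ → ℝ be continuously differentiable and symmetric. Let G be the associated function on real symmetric n×n matrices defined by G(A) := g(λ(A)), where λ(A) is the vector of eigenvalues of A (g symmetric makes this independent of the ordering), defined for all symmetric A whose eigenvalue vector lies in Γ. Then at any diagonal matrix A = diag(z₁,…,zₙ) with z ∈ Γ, the function G (restricted to the space of symmetric matrices) is differentiable, and its derivative in the direction of a symmetric matrix B is Σₖ (∂g/∂zₖ)(z)·B_{kk}. -/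
open Matrix Filter Topology Asymptotics

/-- The squared entries of an orthogonal diagonalization of `A` form a doubly stochastic matrix
which expresses the diagonal of `A`, and the distance from `A` to a diagonal matrix, through the
eigenvalues of `A`. -/
lemma Matrix.IsHermitian.exists_mem_doublyStochastic {ι : Type*} [Fintype ι] [DecidableEq ι]
    {A : Matrix ι ι ℝ} (hA : A.IsHermitian) :
    ∃ P ∈ doublyStochastic ℝ ι, (∀ k, A k k = ∑ i, P k i * hA.eigenvalues i) ∧
      ∀ z : ι → ℝ, ∑ k, ∑ i, P k i * (z k - hA.eigenvalues i) ^ 2 =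
        ∑ k, ∑ l, (A k l - diagonal z k l) ^ 2 := by
  set U : Matrix ι ι ℝ := (hA.eigenvectorUnitary : Matrix ι ι ℝ) with hU
  have hUU : U * Uᵀ = 1 := Unitary.coe_mul_star_self hA.eigenvectorUnitary
  have hUU' : Uᵀ * U = 1 := Unitary.coe_star_mul_self hA.eigenvectorUnitary
  have hspec : A = U * diagonal hA.eigenvalues * Uᵀ := by
    have := hA.spectral_theorem
    rw [Unitary.conjStarAlgAut_apply] at this
    exact this
  have hAU : A * U = U * diagonal hA.eigenvalues := by
    conv_lhs => rw [hspec, Matrix.mul_assoc, hUU', Matrix.mul_one]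
  refine ⟨of fun k i => U k i ^ 2, ?_, fun k => ?_, fun z => Finset.sum_congr rfl fun k _ => ?_⟩
  · refine mem_doublyStochastic_iff_sum.2 ⟨fun i j => sq_nonneg _, fun i => ?_, fun j => ?_⟩
    · simpa [mul_apply, sq] using congr_fun₂ hUU i i
    · simpa [mul_apply, sq] using congr_fun₂ hUU' j j
  · have := congr_fun₂ hspec k k
    rw [mul_apply] at this
    simp only [mul_diagonal, transpose_apply] at this
    rw [this]
    exact Finset.sum_congr rfl fun i _ => by simp only [of_apply]; ring
  · set v : ι → ℝ := (A - diagonal z) k with hv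
    have h1 : ∀ i, (v ᵥ* U) i = U k i * (hA.eigenvalues i - z k) := fun i => by
      have : (v ᵥ* U) i = ((A - diagonal z) * U) k i := rfl
      rw [this, Matrix.sub_mul, hAU]
      simp only [sub_apply, mul_diagonal, diagonal_mul]
      ring
    have h2 : (v ᵥ* U) ⬝ᵥ (v ᵥ* U) = v ⬝ᵥ v := by
      rw [← mulVec_transpose, dotProduct_mulVec, vecMul_transpose, mulVec_mulVec, hUU,
        one_mulVec]
    simp only [dotProduct, h1] at h2
    calc _ = ∑ i, U k i * (hA.eigenvalues i - z k) * (U k i * (hA.eigenvalues i - z k)) :=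
          Finset.sum_congr rfl fun i _ => by simp only [of_apply]; ring
      _ = _ := h2
      _ = _ := Finset.sum_congr rfl fun i _ => by simp only [hv, sub_apply]; ring

/-- Some permutation does at least as well as a doubly stochastic matrix for a linear cost. -/
lemma exists_perm_sum_le_of_mem_doublyStochastic {ι : Type*} [Fintype ι] [DecidableEq ι]
    {P : Matrix ι ι ℝ} (hP : P ∈ doublyStochastic ℝ ι) (f : ι → ι → ℝ) :
    ∃ σ : Equiv.Perm ι, ∑ k, f k (σ k) ≤ ∑ k, ∑ i, P k i * f k i := by
  obtain ⟨w, hw0, hw1, hwP⟩ := exists_eq_sum_perm_of_mem_doublyStochastic hP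
  have key : ∑ k, ∑ i, P k i * f k i = ∑ σ, w σ * ∑ k, f k (σ k) := by
    have h (k) : ∑ i, P k i * f k i = ∑ σ, w σ * f k (σ k) := by
      simp only [← hwP, Matrix.sum_apply, Finset.sum_mul]
      rw [Finset.sum_comm]
      refine Finset.sum_congr rfl fun σ _ => ?_
      simp [Matrix.smul_apply, PEquiv.toMatrix_apply]
    simp only [h, Finset.mul_sum]
    exact Finset.sum_comm
  by_contra! hlt
  have hsum : ∑ σ, w σ * (∑ k, ∑ i, P k i * f k i) = ∑ k, ∑ i, P k i * f k i := by
    rw [← Finset.sum_mul, hw1, one_mul]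
  obtain ⟨σ, hσ⟩ : ∃ σ, w σ ≠ 0 := by
    by_contra! h
    simp [h] at hw1
  refine absurd (hsum.trans key) (ne_of_lt (Finset.sum_lt_sum (fun τ _ => ?_)
    ⟨σ, Finset.mem_univ _, ?_⟩))
  · exact mul_le_mul_of_nonneg_left (hlt τ).le (hw0 τ)
  · exact mul_lt_mul_of_pos_left (hlt σ) ((hw0 σ).lt_of_ne' hσ)

/-- The Hoffman–Wielandt inequality against a diagonal matrix, together with the doubly stochastic
matrix relating the suitably ordered eigenvalues to the diagonal entries. -/
lemma Matrix.IsHermitian.exists_perm_eigenvalues {ι : Type*} [Fintype ι] [DecidableEq ι]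
    {A : Matrix ι ι ℝ} (hA : A.IsHermitian) (z : ι → ℝ) :
    ∃ (σ : Equiv.Perm ι) (P : ι → ι → ℝ), (∀ k i, 0 ≤ P k i) ∧ (∀ i, ∑ k, P k i = 1) ∧
      (∀ k, A k k = ∑ i, P k i * hA.eigenvalues (σ i)) ∧
      ∑ k, ∑ i, P k i * (z k - hA.eigenvalues (σ i)) ^ 2 =
        ∑ k, ∑ l, (A k l - diagonal z k l) ^ 2 ∧
      ∑ k, (z k - hA.eigenvalues (σ k)) ^ 2 ≤ ∑ k, ∑ l, (A k l - diagonal z k l) ^ 2 := by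
  obtain ⟨P, hP, hdiag, hdist⟩ := hA.exists_mem_doublyStochastic
  obtain ⟨σ, hσ⟩ := exists_perm_sum_le_of_mem_doublyStochastic hP
    fun k i => (z k - hA.eigenvalues i) ^ 2
  refine ⟨σ, fun k i => P k (σ i), fun k i => nonneg_of_mem_doublyStochastic hP,
    fun i => sum_col_of_mem_doublyStochastic hP _, fun k => ?_, ?_, hσ.trans (hdist z).le⟩
  · rw [hdiag, ← Equiv.sum_comp σ]
  · rw [← hdist z]
    exact Finset.sum_congr rfl fun k _ =>
      Equiv.sum_comp σ fun i => P k i * (z k - hA.eigenvalues i) ^ 2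

/-- Partial derivatives of a symmetric function agree along equal coordinates. -/
lemma fderiv_single_eq_of_symmetric {ι : Type*} [Fintype ι] [DecidableEq ι] {Γ : Set (ι → ℝ)}
    {g : (ι → ℝ) → ℝ} {z : ι → ℝ} (hΓ : Γ ∈ 𝓝 z) (hg : DifferentiableAt ℝ g z)
    (hgsymm : ∀ σ : Equiv.Perm ι, ∀ y ∈ Γ, g (fun i => y (σ i)) = g y) {k l : ι}
    (hkl : z k = z l) :
    fderiv ℝ g z (Pi.single k 1) = fderiv ℝ g z (Pi.single l 1) := by
  set T : (ι → ℝ) →L[ℝ] (ι → ℝ) :=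
    ContinuousLinearMap.pi fun i => ContinuousLinearMap.proj (Equiv.swap k l i) with hT
  have hTz : T z = z := by
    ext i
    change z (Equiv.swap k l i) = z i
    by_cases hik : i = k
    · simp [hik, hkl]
    · by_cases hil : i = l
      · simp [hil, hkl]
      · rw [Equiv.swap_apply_of_ne_of_ne hik hil]
  have hcomp : HasFDerivAt (g ∘ T) ((fderiv ℝ g z).comp T) z :=
    HasFDerivAt.comp z (by rw [hTz]; exact hg.hasFDerivAt) T.hasFDerivAt
  have heq : g ∘ T =ᶠ[𝓝 z] g := by
    filter_upwards [hΓ] with y hy using hgsymm _ y hy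
  have hD := (hcomp.congr_of_eventuallyEq heq.symm).unique hg.hasFDerivAt
  have hTk : T (Pi.single k 1) = Pi.single l 1 := by
    ext i
    change Pi.single (M := fun _ => ℝ) k 1 (Equiv.swap k l i) = _
    simp only [Pi.single_apply, Equiv.swap_apply_eq_iff, Equiv.swap_apply_left]
  rw [← hTk, ← ContinuousLinearMap.comp_apply, hD]


/-- First derivative of an eigenvalue function, Lemma 2.1 eq. (2.1).
If `g : Γ → ℝ` is `C¹` and symmetric on a permutation-invariant open set `Γ ⊆ ℝⁿ`, and `G`
is the induced function on symmetric matrices, `G(A) = g(λ(A))`, then at any diagonal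
matrix `A = diag(z)` with `z ∈ Γ`, `G` (restricted to symmetric matrices) is
differentiable, with derivative `B ↦ Σₖ (∂g/∂zₖ)(z) B_{kk}` on symmetric directions. -/
theorem stmt_3 (n : ℕ) (Γ : Set (Fin n → ℝ))
    (hΓopen : IsOpen Γ)
    (hΓperm : ∀ σ : Equiv.Perm (Fin n), ∀ z ∈ Γ, (fun i => z (σ i)) ∈ Γ)
    (g : (Fin n → ℝ) → ℝ)
    (hg : ContDiffOn ℝ 1 g Γ)
    (hgsymm : ∀ σ : Equiv.Perm (Fin n), ∀ z ∈ Γ, g (fun i => z (σ i)) = g z)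
    (G : (Fin n → Fin n → ℝ) → ℝ)
    (hG : ∀ (A : Fin n → Fin n → ℝ) (hA : (Matrix.of A).IsHermitian),
      hA.eigenvalues ∈ Γ → G A = g hA.eigenvalues)
    (z : Fin n → ℝ) (hz : z ∈ Γ) :
    ∃ L : (Fin n → Fin n → ℝ) →L[ℝ] ℝ,
      HasFDerivWithinAt G L {A : Fin n → Fin n → ℝ | ∀ i j, A i j = A j i}
        (fun i j => if i = j then z i else 0) ∧
      ∀ B : Fin n → Fin n → ℝ, (∀ i j, B i j = B j i) →
        L B = ∑ k, fderiv ℝ g z (Pi.single k 1) * B k k := by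
  set S : Set (Fin n → Fin n → ℝ) := {A | ∀ i j, A i j = A j i} with hS
  set A₀ : Fin n → Fin n → ℝ := fun i j => if i = j then z i else 0 with hA₀
  have hΓz : Γ ∈ 𝓝 z := hΓopen.mem_nhds hz
  have hgz : DifferentiableAt ℝ g z := (hg.contDiffAt hΓz).differentiableAt one_ne_zero
  have hA₀S : A₀ ∈ S := fun i j => by
    by_cases h : i = j
    · simp [hA₀, h]
    · simp [hA₀, h, Ne.symm h]
  have hfrob (A : Fin n → Fin n → ℝ) :
      ∑ k, ∑ l, (of A k l - diagonal z k l) ^ 2 ≤ (n * ‖A - A₀‖) ^ 2 := by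
    have hentry (k l : Fin n) : (of A k l - diagonal z k l) ^ 2 ≤ ‖A - A₀‖ ^ 2 := by
      have h : ‖(A - A₀) k l‖ ≤ ‖A - A₀‖ := (norm_le_pi_norm _ l).trans (norm_le_pi_norm _ k)
      rw [← sq_abs]
      exact pow_le_pow_left₀ (abs_nonneg _) h 2
    calc _ ≤ ∑ _k : Fin n, ∑ _l : Fin n, ‖A - A₀‖ ^ 2 :=
          Finset.sum_le_sum fun k _ => Finset.sum_le_sum fun l _ => hentry k l
      _ = _ := by simp; ring
  have hex (A : Fin n → Fin n → ℝ) : ∃ (μ : Fin n → ℝ) (P : Fin n → Fin n → ℝ), A ∈ S →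
      (μ ∈ Γ → G A = g μ) ∧ (∀ k i, 0 ≤ P k i) ∧ (∀ i, ∑ k, P k i = 1) ∧
      (∀ k, A k k = ∑ i, P k i * μ i) ∧
      (∀ k i, P k i * (z k - μ i) ^ 2 ≤ (n * ‖A - A₀‖) ^ 2) ∧
      ∀ k, |μ k - z k| ≤ n * ‖A - A₀‖ := by
    by_cases hAS : A ∈ S
    swap
    · exact ⟨0, 0, fun h => absurd h hAS⟩
    have hA : (of A).IsHermitian := by
      ext i j
      exact hAS j i
    obtain ⟨σ, P, hP0, hP1, hdiag, hdist, hle⟩ := hA.exists_perm_eigenvalues z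
    refine ⟨fun i => hA.eigenvalues (σ i), P, fun _ => ⟨fun hμ => ?_, hP0, hP1, hdiag,
      fun k i => ?_, fun k => ?_⟩⟩
    · have hev : hA.eigenvalues ∈ Γ := by simpa using hΓperm σ⁻¹ _ hμ
      rw [hG A hA hev, hgsymm σ _ hev]
    · have hnn (k i : Fin n) : 0 ≤ P k i * (z k - hA.eigenvalues (σ i)) ^ 2 :=
        mul_nonneg (hP0 k i) (sq_nonneg _)
      calc _ ≤ ∑ i, P k i * (z k - hA.eigenvalues (σ i)) ^ 2 :=
            Finset.single_le_sum (f := fun i => P k i * (z k - hA.eigenvalues (σ i)) ^ 2)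
              (fun i _ => hnn k i) (Finset.mem_univ i)
        _ ≤ _ := Finset.single_le_sum
              (f := fun k => ∑ i, P k i * (z k - hA.eigenvalues (σ i)) ^ 2)
              (fun k _ => Finset.sum_nonneg fun i _ => hnn k i) (Finset.mem_univ k)
        _ ≤ _ := hdist.trans_le (hfrob A)
    · rw [abs_sub_comm]
      refine abs_le_of_sq_le_sq ?_ (by positivity)
      exact (Finset.single_le_sum (f := fun k => (z k - hA.eigenvalues (σ k)) ^ 2)
        (fun k _ => sq_nonneg _) (Finset.mem_univ k)).trans (hle.trans (hfrob A))
  choose μ P hμP using hex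
  set c : Fin n → ℝ := fun k => fderiv ℝ g z (Pi.single k 1) with hc
  have hgc (v : Fin n → ℝ) : fderiv ℝ g z v = ∑ k, c k * v k := by
    conv_lhs => rw [pi_eq_sum_univ' v, map_sum]
    exact Finset.sum_congr rfl fun k _ => by
      rw [map_smul, smul_eq_mul, mul_comm]
  have hmem : ∀ᶠ A in 𝓝[S] A₀, A ∈ S := self_mem_nhdsWithin
  have hμO : (fun A => μ A - z) =O[𝓝[S] A₀] fun A => A - A₀ := by
    refine IsBigO.of_bound n ?_
    filter_upwards [hmem] with A hA
    exact (pi_norm_le_iff_of_nonneg (by positivity)).2 fun k => (hμP A hA).2.2.2.2.2 k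
  have hsub : Tendsto (fun A => A - A₀) (𝓝[S] A₀) (𝓝 0) := by
    rw [← sub_self A₀]
    exact (tendsto_id.sub tendsto_const_nhds).mono_left nhdsWithin_le_nhds
  have hμz : Tendsto μ (𝓝[S] A₀) (𝓝 z) := by
    simpa using (hμO.trans_tendsto hsub).add_const z
  have hGμ : ∀ᶠ A in 𝓝[S] A₀, G A = g (μ A) := by
    filter_upwards [hmem, hμz hΓz] with A hA hΓ using (hμP A hA).1 hΓ
  have hA₀μ : μ A₀ = z := by
    ext k
    simpa [sub_eq_zero] using (hμP A₀ hA₀S).2.2.2.2.2 k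
  have hGA₀ : G A₀ = g z := by
    rw [(hμP A₀ hA₀S).1 (by rwa [hA₀μ]), hA₀μ]
  have hterm (k i : Fin n) : (fun A => P A k i * (c k - c i) * μ A i) =O[𝓝[S] A₀]
      fun A => ‖A - A₀‖ ^ 2 := by
    by_cases hki : z k = z i
    · have : c k = c i := fderiv_single_eq_of_symmetric hΓz hgz hgsymm hki
      simpa [this] using isBigO_zero _ _
    have hμi : Tendsto (fun A => μ A i) (𝓝[S] A₀) (𝓝 (z i)) :=
      (tendsto_pi_nhds.1 hμz) i
    have hne : ∀ᶠ A in 𝓝[S] A₀, μ A i ≠ z k := hμi.eventually_ne (Ne.symm hki)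
    have h1 : (fun A => P A k i * (z k - μ A i) ^ 2) =O[𝓝[S] A₀] fun A => ‖A - A₀‖ ^ 2 := by
      refine IsBigO.of_bound ((n : ℝ) ^ 2) ?_
      filter_upwards [hmem] with A hA
      obtain ⟨-, hP0, -, -, hle, -⟩ := hμP A hA
      rw [Real.norm_of_nonneg (mul_nonneg (hP0 k i) (sq_nonneg _)),
        Real.norm_of_nonneg (sq_nonneg _), ← mul_pow]
      exact hle k i
    have h2 : (fun A => (c k - c i) * μ A i / (z k - μ A i) ^ 2) =O[𝓝[S] A₀]
        fun _ => (1 : ℝ) :=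
      ((hμi.const_mul (c k - c i)).div ((hμi.const_sub (z k)).pow 2)
        (pow_ne_zero 2 (sub_ne_zero.2 hki))).isBigO_one ℝ
    refine (h1.mul h2).congr' ?_ (by simp)
    filter_upwards [hne] with A hA
    have : z k - μ A i ≠ 0 := sub_ne_zero.2 hA.symm
    field_simp
  have hlin : (fun A => ∑ k, c k * (A k k - μ A k)) =O[𝓝[S] A₀] fun A => ‖A - A₀‖ ^ 2 := by
    refine (IsBigO.sum fun k (_ : k ∈ Finset.univ) =>
      IsBigO.sum fun i (_ : i ∈ Finset.univ) => hterm k i).congr' ?_ EventuallyEq.rfl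
    filter_upwards [hmem] with A hA
    obtain ⟨-, -, hP1, hdiag, -, -⟩ := hμP A hA
    have hcol : ∑ k, ∑ i, P A k i * (c i * μ A i) = ∑ k, c k * μ A k := by
      rw [Finset.sum_comm]
      simp only [← Finset.sum_mul, hP1, one_mul]
    simp only [Finset.sum_apply, mul_sub, Finset.sum_sub_distrib, ← hcol, hdiag, Finset.mul_sum]
    simp only [← Finset.sum_sub_distrib]
    exact Finset.sum_congr rfl fun k _ => Finset.sum_congr rfl fun i _ => by ring
  have hlin' : (fun A => ∑ k, c k * (A k k - μ A k)) =o[𝓝[S] A₀] fun A => A - A₀ := by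
    refine hlin.trans_isLittleO (IsLittleO.of_norm_right ?_)
    simpa [sq] using ((isLittleO_one_iff ℝ).2 (tendsto_norm_zero.comp hsub)).mul_isBigO
      (isBigO_refl (fun A => ‖A - A₀‖) _)
  have hgo : (fun A => g (μ A) - g z - fderiv ℝ g z (μ A - z)) =o[𝓝[S] A₀] fun A => A - A₀ :=
    (hgz.hasFDerivAt.isLittleO.comp_tendsto hμz).trans_isBigO hμO
  refine ⟨∑ k, c k • (ContinuousLinearMap.proj (R := ℝ) (φ := fun _ : Fin n => ℝ) k).comp
    (ContinuousLinearMap.proj (R := ℝ) (φ := fun _ : Fin n => Fin n → ℝ) k), ?_, fun B _ => ?_⟩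
  · refine .of_isLittleO ((hgo.sub hlin').congr' ?_ EventuallyEq.rfl)
    filter_upwards [hGμ] with A hA
    rw [hA, hGA₀, hgc, sub_sub, ← Finset.sum_add_distrib]
    simp only [_root_.sum_apply, _root_.smul_apply,
      ContinuousLinearMap.comp_apply, ContinuousLinearMap.proj_apply, Pi.sub_apply, smul_eq_mul]
    congr 1
    exact Finset.sum_congr rfl fun k _ => by simp only [hA₀, if_true]; ring
  · simp [hc]
end

section
/- Let Γ ⊆ ℝⁿ be an open set invariant under permutations of the coordinates, and let g : Γ → ℝ be twice continuously differentiable and symmetric. Let G be the associated function on real symmetric n×n matrices defined by G(A) := g(λ(A)). Then at any diagonal matrix A = diag(z₁,…,zₙ) with z ∈ Γ having pairwise distinct entries, G (restricted to the space of symmetric matrices) is twice differentiable, and its second derivative evaluated at the pair (B,B) for a symmetric matrix B equals Σ_{p,q} (∂²g/∂z_p∂z_q)(z)·B_{pp}·B_{qq} + 2·Σ_{p>q} [((∂g/∂z_p)(z) − (∂g/∂z_q)(z))/(z_p − z_q)]·(B_{pq})². -/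
open Filter Topology

/-- A Hermitian real matrix with an eigenvector for each of the pairwise distinct numbers `μ p`
has the `μ p` as its eigenvalues, up to order. -/
lemma exists_perm_eigenvalues_eq {ι : Type*} [Fintype ι] [DecidableEq ι] {A : Matrix ι ι ℝ}
    (hA : A.IsHermitian) {μ : ι → ℝ} (hμ : Function.Injective μ)
    (h : ∀ p, ∃ v : ι → ℝ, v ≠ 0 ∧ A.mulVec v = μ p • v) :
    ∃ σ : Equiv.Perm ι, hA.eigenvalues = fun i => μ (σ i) := by
  have key : ∀ p, ∃ i, hA.eigenvalues i = μ p := by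
    intro p
    obtain ⟨v, hv, hAv⟩ := h p
    have hmem : μ p ∈ spectrum ℝ A := by
      rw [spectrum.mem_iff, Matrix.isUnit_iff_isUnit_det, isUnit_iff_ne_zero, not_not,
        ← Matrix.exists_mulVec_eq_zero_iff]
      refine ⟨v, hv, ?_⟩
      rw [Matrix.sub_mulVec, hAv, Algebra.algebraMap_eq_smul_one, Matrix.smul_mulVec,
        Matrix.one_mulVec, sub_self]
    rwa [hA.spectrum_real_eq_range_eigenvalues] at hmem
  choose f hf using key
  have hinj : Function.Injective f := fun p q hpq => hμ (by rw [← hf p, ← hf q, hpq])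
  refine ⟨(Equiv.ofBijective f (Finite.injective_iff_bijective.mp hinj)).symm, ?_⟩
  funext i
  rw [← hf]
  exact congrArg _ ((Equiv.ofBijective f _).apply_symm_apply i).symm

/-- A simple eigenvalue of a diagonal matrix and its normalized eigenvector extend to `C²` curves
of eigenvalues and eigenvectors along every affine line of matrices. -/
lemma exists_contDiffAt_eigenpair {ι : Type*} [Fintype ι] [DecidableEq ι] {z : ι → ℝ}
    (hz : Function.Injective z) (B : ι → ι → ℝ) (p : ι) :
    ∃ (x : ℝ → ℝ) (v : ℝ → ι → ℝ), ContDiffAt ℝ 2 x 0 ∧ ContDiffAt ℝ 2 v 0 ∧ x 0 = z p ∧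
      v 0 = Pi.single p 1 ∧ (∀ t, v t p = 1) ∧
      ∀ᶠ t in 𝓝 (0 : ℝ), ∀ i, z i * v t i + t * ∑ j, B i j * v t j = x t * v t i := by
  let V : (ι → ℝ) → ι → ℝ := fun y i => if i = p then 1 else y i
  have hV : ContDiff ℝ 2 V := by
    refine contDiff_pi.2 fun i => ?_
    by_cases hi : i = p
    · simpa [V, hi] using contDiff_const
    · simpa [V, hi] using contDiff_apply ℝ ℝ i
  let f : ℝ × (ι → ℝ) → ι → ℝ := fun u i =>
    (z i - u.2 p) * V u.2 i + u.1 * ∑ j, B i j * V u.2 j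
  have hf : ContDiff ℝ 2 f := by
    have hVi : ∀ i, ContDiff ℝ 2 fun u : ℝ × (ι → ℝ) => V u.2 i := fun i =>
      (contDiff_pi.1 hV i).comp contDiff_snd
    refine contDiff_pi.2 fun i => ?_
    refine ContDiff.add (ContDiff.mul (by fun_prop) (hVi i)) (ContDiff.mul contDiff_fst ?_)
    exact ContDiff.sum fun j _ => contDiff_const.mul (hVi j)
  let y₀ : ι → ℝ := Pi.single p (z p)
  let c : ι → ℝ := fun i => if i = p then -1 else z i - z p
  have hc : ∀ i, c i ≠ 0 := by
    intro i
    by_cases hi : i = p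
    · simp [c, hi]
    · simpa [c, hi, sub_eq_zero] using fun h => hi (hz h)
  let L : (ι → ℝ) ≃L[ℝ] (ι → ℝ) := ContinuousLinearEquiv.piCongrRight fun i =>
    ContinuousLinearEquiv.unitsEquivAut ℝ (Units.mk0 (c i) (hc i))
  have hcomp : HasFDerivAt (fun y => f (0, y))
      (fderiv ℝ f (0, y₀) ∘L .inr ℝ ℝ (ι → ℝ)) y₀ :=
    ((hf.differentiable (by norm_num)) (0, y₀)).hasFDerivAt.comp y₀ (hasFDerivAt_prodMk_right 0 y₀)
  have hL : HasFDerivAt (fun y => f (0, y)) (L : (ι → ℝ) →L[ℝ] ι → ℝ) y₀ := by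
    refine hasFDerivAt_pi'.2 fun i => ?_
    have hproj : ∀ j : ι, HasFDerivAt (fun y : ι → ℝ => y j)
        (ContinuousLinearMap.proj (R := ℝ) (φ := fun _ : ι => ℝ) j) y₀ :=
      fun j => hasFDerivAt_apply j y₀
    by_cases hi : i = p
    · subst hi
      convert! (hproj i).const_sub (z i) using 1
      · funext y; simp [f, V]
      · ext y; simp [L, c]
    · convert! ((hproj p).const_sub (z i)).mul (hproj i) using 1
      · funext y; simp [f, V, hi]
      · ext y; simp [L, c, y₀, hi, mul_comm]
  have hinv : (fderiv ℝ f (0, y₀) ∘L .inr ℝ ℝ (ι → ℝ)).IsInvertible := ⟨L, hL.unique hcomp⟩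
  have h0 : f (0, y₀) = 0 := by
    funext i
    by_cases hi : i = p <;> simp [f, V, y₀, hi]
  let ψ := hf.contDiffAt.implicitFunction (by norm_num) hinv
  have hψ : ContDiffAt ℝ 2 ψ 0 :=
    hf.contDiffAt.contDiffAt_implicitFunction (by norm_num) hinv
  have hψ0 : ψ 0 = y₀ := hf.contDiffAt.implicitFunction_apply_self (by norm_num) hinv
  refine ⟨fun t => ψ t p, fun t => V (ψ t), contDiffAt_pi.1 hψ p,
    hV.contDiffAt.comp 0 hψ, by simp [hψ0, y₀], ?_, fun t => by simp [V], ?_⟩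
  · funext i
    by_cases hi : i = p
    · subst hi; simp [V]
    · simp [V, hψ0, y₀, hi]
  · filter_upwards [hf.contDiffAt.eventually_apply_implicitFunction (by norm_num) hinv]
      with t ht i
    have := congrFun (ht.trans h0) i
    simp only [f, Pi.zero_apply] at this
    linear_combination this

/-- First and second order perturbation of a simple eigenvalue of a diagonal matrix. The term
`q = p` of the sum vanishes, since division by zero gives zero. -/
lemma exists_eigenvalue_curve {ι : Type*} [Fintype ι] [DecidableEq ι] {z : ι → ℝ}
    (hz : Function.Injective z) (B : ι → ι → ℝ) (p : ι) :
    ∃ x : ℝ → ℝ, ContDiffAt ℝ 2 x 0 ∧ x 0 = z p ∧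
      deriv x 0 = B p p ∧
      HasDerivAt (deriv x) (2 * ∑ q, B p q * B q p / (z p - z q)) 0 ∧
      ∀ᶠ t in 𝓝 (0 : ℝ), ∃ v : ι → ℝ, v ≠ 0 ∧
        (Matrix.of fun i j => (if i = j then z i else 0) + t * B i j).mulVec v = x t • v := by
  obtain ⟨x, v, hx, hv, hx0, hv0, hvp, hev⟩ := exists_contDiffAt_eigenpair hz B p
  have hvi : ∀ i, ContDiffAt ℝ 2 (fun t => v t i) 0 := contDiffAt_pi.1 hv
  let w : ι → ℝ → ℝ := fun i t => ∑ j, B i j * v t j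
  have hw : ∀ i, ContDiffAt ℝ 2 (w i) 0 := fun i =>
    ContDiffAt.sum fun j _ => contDiffAt_const.mul (hvi j)
  have hw0 : ∀ i, w i 0 = B i p := fun i => by simp [w, hv0, Pi.single_apply]
  have hvd : ∀ i, HasDerivAt (fun t => v t i) (deriv (fun t => v t i) 0) 0 := fun i =>
    ((hvi i).differentiableAt (by norm_num)).hasDerivAt
  have hwd : ∀ i, HasDerivAt (w i) (deriv (w i) 0) 0 := fun i =>
    ((hw i).differentiableAt (by norm_num)).hasDerivAt
  have hxd : HasDerivAt x (deriv x 0) 0 := (hx.differentiableAt (by norm_num)).hasDerivAt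
  have hxw : x =ᶠ[𝓝 0] fun t => z p + t * w p t := by
    filter_upwards [hev] with t ht
    have := ht p
    rw [hvp] at this
    linear_combination -this
  have hxderiv : deriv x =ᶠ[𝓝 0] fun t => w p t + t * deriv (w p) t := by
    filter_upwards [hxw.eventuallyEq_nhds, (hw p).eventually (by norm_num)] with t ht hwt
    rw [ht.deriv_eq]
    have h := ((hasDerivAt_id' t).mul (hwt.differentiableAt (by norm_num)).hasDerivAt).const_add
      (z p)
    simpa using h.deriv
  have hvderiv : ∀ i, i ≠ p → deriv (fun t => v t i) 0 = B i p / (z p - z i) := by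
    intro i hi
    have hl : HasDerivAt (fun t => (x t - z i) * v t i)
        (deriv x 0 * v 0 i + (x 0 - z i) * deriv (fun t => v t i) 0) 0 :=
      (hxd.sub_const (z i)).mul (hvd i)
    have hr : HasDerivAt (fun t => t * w i t) (1 * w i 0 + 0 * deriv (w i) 0) 0 :=
      (hasDerivAt_id' (0 : ℝ)).mul (hwd i)
    have heq : (fun t => t * w i t) =ᶠ[𝓝 0] fun t => (x t - z i) * v t i := by
      filter_upwards [hev] with t ht
      linear_combination ht i
    have h := (hl.congr_of_eventuallyEq heq).unique hr
    have hne : z p - z i ≠ 0 := sub_ne_zero.2 fun h => hi (hz h).symm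
    rw [hv0, hx0, hw0, Pi.single_eq_of_ne hi] at h
    rw [eq_div_iff hne]
    linear_combination h
  have hvpderiv : deriv (fun t => v t p) 0 = 0 := by simp [hvp]
  have hwderiv : deriv (w p) 0 = ∑ q, B p q * B q p / (z p - z q) := by
    have : HasDerivAt (w p) (∑ q, B p q * deriv (fun t => v t q) 0) 0 :=
      HasDerivAt.fun_sum fun j _ => (hvd j).const_mul _
    rw [this.deriv]
    refine Finset.sum_congr rfl fun q _ => ?_
    by_cases hq : q = p
    · subst hq; simp [hvpderiv]
    · rw [hvderiv q hq, mul_div_assoc]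
  refine ⟨x, hx, hx0, ?_, ?_, ?_⟩
  · rw [hxderiv.eq_of_nhds, hw0]; simp
  · have hdw : DifferentiableAt ℝ (deriv (w p)) 0 := by
      simp only [funext fun t => (fderiv_apply_one_eq_deriv (f := w p) (x := t)).symm]
      exact (((hw p).fderiv_right (m := 1) (by norm_num)).differentiableAt
        (by norm_num)).clm_apply (differentiableAt_const _)
    have h := (hwd p).add ((hasDerivAt_id' (0 : ℝ)).mul hdw.hasDerivAt)
    refine HasDerivAt.congr_of_eventuallyEq ?_ hxderiv
    convert! h using 1
    rw [← hwderiv]; ring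
  · filter_upwards [hev] with t ht
    refine ⟨v t, fun h => by simpa [h] using hvp t, ?_⟩
    funext i
    simp only [Matrix.mulVec, dotProduct, Matrix.of_apply, Pi.smul_apply, smul_eq_mul, add_mul,
      ite_mul, zero_mul, Finset.sum_add_distrib, Finset.sum_ite_eq, Finset.mem_univ, if_true]
    rw [← ht i, Finset.mul_sum]
    simp only [mul_assoc]

/-- A double sum without diagonal terms, folded onto the pairs below the diagonal. -/
lemma sum_sum_eq_sum_sum_lt {ι : Type*} [Fintype ι] [LinearOrder ι] (f : ι → ι → ℝ)
    (hf : ∀ p, f p p = 0) :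
    ∑ p, ∑ q, f p q = ∑ p, ∑ q ∈ Finset.univ.filter (fun q => q < p), (f p q + f q p) := by
  have h : ∀ p q, f p q = (if q < p then f p q else 0) + (if p < q then f p q else 0) := by
    intro p q
    rcases lt_trichotomy p q with h | h | h
    · simp [h, h.not_gt]
    · subst h; simp [hf]
    · simp [h, h.not_gt]
  simp only [Finset.sum_filter]
  calc ∑ p, ∑ q, f p q = ∑ p, ∑ q, ((if q < p then f p q else 0) + (if p < q then f p q else 0)) :=
        Finset.sum_congr rfl fun p _ => Finset.sum_congr rfl fun q _ => h p q
    _ = ∑ p, ∑ q, (if q < p then f p q else 0) + ∑ p, ∑ q, (if q < p then f q p else 0) := by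
        simp only [Finset.sum_add_distrib]
        rw [Finset.sum_comm (f := fun p q => if p < q then f p q else 0)]
    _ = _ := by
        simp only [← Finset.sum_add_distrib]
        refine Finset.sum_congr rfl fun p _ => Finset.sum_congr rfl fun q _ => ?_
        split_ifs <;> simp

/-- The second derivative of a `C²` function along a `C²` curve, in coordinates. -/
lemma hasDerivAt_deriv_comp_curve {ι : Type*} [Fintype ι] [DecidableEq ι] {g : (ι → ℝ) → ℝ}
    {μ : ℝ → ι → ℝ} {z b c : ι → ℝ} (hg : ContDiffAt ℝ 2 g z) (hμ : ContDiffAt ℝ 2 μ 0)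
    (hμ0 : μ 0 = z) (hb : ∀ p, deriv (fun t => μ t p) 0 = b p)
    (hc : ∀ p, HasDerivAt (deriv fun t => μ t p) (c p) 0) :
    HasDerivAt (deriv fun t => g (μ t))
      ((∑ p, ∑ q, fderiv ℝ (fun w => fderiv ℝ g w (Pi.single p 1)) z (Pi.single q 1) * b p * b q)
        + ∑ p, fderiv ℝ g z (Pi.single p 1) * c p) 0 := by
  have happly : ∀ (l : (ι → ℝ) →L[ℝ] ℝ) (u : ι → ℝ), l u = ∑ p, l (Pi.single p 1) * u p := by
    intro l u
    conv_lhs => rw [pi_eq_sum_univ' u, map_sum]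
    refine Finset.sum_congr rfl fun p _ => ?_
    rw [map_smul, smul_eq_mul, mul_comm]
  have hμp : ∀ᶠ t in 𝓝 (0 : ℝ), HasDerivAt μ (fun p => deriv (fun s => μ s p) t) t := by
    filter_upwards [hμ.eventually (by norm_num)] with t ht
    exact hasDerivAt_pi.2 fun p =>
      ((contDiffAt_pi.1 ht p).differentiableAt (by norm_num)).hasDerivAt
  have hcont : Tendsto μ (𝓝 0) (𝓝 z) := hμ0 ▸ hμ.continuousAt
  have hderiv : (deriv fun t => g (μ t)) =ᶠ[𝓝 0]
      fun t => ∑ p, fderiv ℝ g (μ t) (Pi.single p 1) * deriv (fun s => μ s p) t := by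
    filter_upwards [hμp, hcont.eventually (hg.eventually (by norm_num))] with t ht hgt
    rw [← happly]
    exact ((hgt.differentiableAt (by norm_num)).hasFDerivAt.comp_hasDerivAt t ht).deriv
  have hμ0' : HasDerivAt μ b 0 := by simpa only [hb] using hμp.self_of_nhds
  refine HasDerivAt.congr_of_eventuallyEq ?_ hderiv
  rw [← Finset.sum_add_distrib]
  refine HasDerivAt.fun_sum fun p _ => ?_
  have hfd : DifferentiableAt ℝ (fun w => fderiv ℝ g w (Pi.single p 1)) z :=
    ((hg.fderiv_right (m := 1) (by norm_num)).differentiableAt (by norm_num)).clm_apply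
      (differentiableAt_const _)
  have h1 : HasDerivAt (fun t => fderiv ℝ g (μ t) (Pi.single p 1))
      (fderiv ℝ (fun w => fderiv ℝ g w (Pi.single p 1)) z b) 0 :=
    hfd.hasFDerivAt.comp_hasDerivAt_of_eq (0 : ℝ) hμ0' hμ0.symm
  convert! h1.mul (hc p) using 1
  rw [hμ0, hb, happly _ b, Finset.sum_mul]
  congr 1
  exact Finset.sum_congr rfl fun q _ => by ring

/-- Second derivative of an eigenvalue function, Lemma 2.1 eq. (2.2).
If `g : Γ → ℝ` is `C²` and symmetric on a permutation-invariant open set `Γ ⊆ ℝⁿ` and `G`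
is the induced function on symmetric matrices, `G(A) = g(λ(A))`, then at a diagonal matrix
`A = diag(z)` with pairwise distinct entries `z ∈ Γ`, `G` restricted to symmetric matrices
is twice differentiable; its second derivative in a symmetric direction `B` (i.e. the
second derivative of `s ↦ G(A + sB)` at `s = 0`) equals
`Σ_{p,q} g_{pq}(z) B_{pp} B_{qq} + 2 Σ_{p>q} ((g_p(z) - g_q(z))/(z_p - z_q)) B_{pq}²`. -/
theorem stmt_4 (n : ℕ) (Γ : Set (Fin n → ℝ))
    (hΓopen : IsOpen Γ)
    (hΓperm : ∀ σ : Equiv.Perm (Fin n), ∀ z ∈ Γ, (fun i => z (σ i)) ∈ Γ)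
    (g : (Fin n → ℝ) → ℝ)
    (hg : ContDiffOn ℝ 2 g Γ)
    (hgsymm : ∀ σ : Equiv.Perm (Fin n), ∀ z ∈ Γ, g (fun i => z (σ i)) = g z)
    (G : (Fin n → Fin n → ℝ) → ℝ)
    (hG : ∀ (A : Fin n → Fin n → ℝ) (hA : (Matrix.of A).IsHermitian),
      hA.eigenvalues ∈ Γ → G A = g hA.eigenvalues)
    (z : Fin n → ℝ) (hz : z ∈ Γ) (hzdist : Function.Injective z)
    (B : Fin n → Fin n → ℝ) (hB : ∀ i j, B i j = B j i) :
    ∃ U ∈ nhds (0 : ℝ),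
      (∀ s ∈ U, DifferentiableAt ℝ
        (fun t : ℝ => G (fun i j => (if i = j then z i else 0) + t * B i j)) s) ∧
      HasDerivAt
        (deriv (fun t : ℝ => G (fun i j => (if i = j then z i else 0) + t * B i j)))
        ((∑ p, ∑ q,
            fderiv ℝ (fun w => fderiv ℝ g w (Pi.single p 1)) z (Pi.single q 1)
              * B p p * B q q)
          + 2 * ∑ p, ∑ q ∈ Finset.univ.filter (fun q => q < p),
              ((fderiv ℝ g z (Pi.single p 1) - fderiv ℝ g z (Pi.single q 1))
                / (z p - z q)) * (B p q) ^ 2)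
        0 := by
  choose x hx hx0 hx1 hx2 hxev using fun p => exists_eigenvalue_curve hzdist B p
  let μ : ℝ → Fin n → ℝ := fun t p => x p t
  have hμ : ContDiffAt ℝ 2 μ 0 := contDiffAt_pi.2 hx
  have hμ0 : μ 0 = z := funext hx0
  have hcont : Tendsto μ (𝓝 0) (𝓝 z) := hμ0 ▸ hμ.continuousAt
  have hgz : ContDiffAt ℝ 2 g z := hg.contDiffAt (hΓopen.mem_nhds hz)
  have hinj : ∀ᶠ t in 𝓝 (0 : ℝ), Function.Injective (μ t) := by
    have : ∀ p q, p ≠ q → ∀ᶠ t in 𝓝 (0 : ℝ), μ t p ≠ μ t q := fun p q hpq =>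
      ((tendsto_pi_nhds.1 hcont p).sub (tendsto_pi_nhds.1 hcont q)).eventually_ne
        (sub_ne_zero.2 (hzdist.ne hpq)) |>.mono fun _ h => sub_ne_zero.1 h
    simp only [← eventually_all] at this
    filter_upwards [this] with t ht p q hpq
    by_contra hne
    exact ht p q hne hpq
  have hGμ : (fun t : ℝ => G (fun i j => (if i = j then z i else 0) + t * B i j)) =ᶠ[𝓝 0]
      fun t => g (μ t) := by
    filter_upwards [hinj, hcont.eventually (hΓopen.mem_nhds hz), eventually_all.2 hxev]
      with t hti htΓ htv
    have hA : (Matrix.of fun i j => (if i = j then z i else 0) + t * B i j).IsHermitian := by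
      ext i j
      by_cases hij : i = j
      · subst hij; simp
      · simp [hij, Ne.symm hij, hB i j]
    obtain ⟨σ, hσ⟩ := exists_perm_eigenvalues_eq hA hti htv
    rw [hG _ hA (hσ ▸ hΓperm σ _ htΓ), hσ, hgsymm σ _ htΓ]
  have hdiff : ∀ᶠ s in 𝓝 (0 : ℝ), DifferentiableAt ℝ (fun t => g (μ t)) s := by
    have h : ContDiffAt ℝ 2 (fun t => g (μ t)) 0 := ContDiffAt.comp 0 (hμ0 ▸ hgz) hμ
    filter_upwards [h.eventually (by norm_num)] with s hs
    exact hs.differentiableAt (by norm_num)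
  refine ⟨_, hdiff.and hGμ.eventuallyEq_nhds, fun s hs => hs.1.congr_of_eventuallyEq hs.2, ?_⟩
  have hsnd := hasDerivAt_deriv_comp_curve hgz hμ hμ0 hx1 hx2
  refine HasDerivAt.congr_of_eventuallyEq ?_ hGμ.deriv
  convert! hsnd using 2
  simp only [Finset.mul_sum]
  rw [sum_sum_eq_sum_sum_lt _ (fun p => by simp)]
  refine Finset.sum_congr rfl fun p _ => Finset.sum_congr rfl fun q hq => ?_
  have hne : z p - z q ≠ 0 := sub_ne_zero.2 (hzdist.ne (Finset.mem_filter.1 hq).2.ne')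
  have hne' : z q - z p ≠ 0 := sub_ne_zero.2 (hzdist.ne (Finset.mem_filter.1 hq).2.ne)
  rw [hB q p, ← neg_sub (z p) (z q), div_neg]
  field_simp
  ring
end

section
/- Let n ≥ 2 and 0 ≤ m ≤ n−1, let ψ : ℝ → ℝ be nondecreasing, let z ∈ ℝⁿ, and let p, q ∈ {1,…,n} with z_p > z_q. Then Σ_{S} ψ(Σ_{i∈S} zᵢ) taken over all subsets S ⊆ {1,…,n} with |S| = m+1 and p ∈ S is greater than or equal to Σ_{S} ψ(Σ_{i∈S} zᵢ) taken over all subsets S ⊆ {1,…,n} with |S| = m+1 and q ∈ S. -/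
/-- Exchanging `p` and `q` does not decrease the sum of `z` over a set containing `q`,
when `z q ≤ z p`. -/
theorem sum_le_sum_map_swap {ι : Type*} [DecidableEq ι] {z : ι → ℝ} {p q : ι}
    (hpq : z q ≤ z p) {S : Finset ι} (hq : q ∈ S) :
    ∑ i ∈ S, z i ≤ ∑ i ∈ S.map (Equiv.swap p q).toEmbedding, z i := by
  by_cases hp : p ∈ S
  · have h : S.map (Equiv.swap p q).toEmbedding = S := by
      ext i
      rw [Finset.mem_map_equiv, Equiv.symm_swap, Equiv.swap_apply_def]
      grind
    rw [h]
  · rw [Finset.sum_map]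
    refine Finset.sum_le_sum fun i hi => ?_
    rw [Equiv.coe_toEmbedding, Equiv.swap_apply_def]
    grind

/-- Pairing lemma, Lemma 3.2.  For a nondecreasing `ψ : ℝ → ℝ`,
`z ∈ ℝⁿ` and indices `p, q` with `z_p > z_q`, the sum of `ψ(Σ_{i∈S} zᵢ)` over all
`(m+1)`-element subsets `S` containing `p` dominates the corresponding sum over subsets
containing `q`. -/
theorem stmt_6 (n m : ℕ) (hn : 2 ≤ n) (hm : m ≤ n - 1)
    (ψ : ℝ → ℝ) (hψ : Monotone ψ)
    (z : Fin n → ℝ) (p q : Fin n) (hpq : z q < z p) :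
    ∑ S ∈ (Finset.powersetCard (m + 1) (Finset.univ : Finset (Fin n))).filter
        (fun S => q ∈ S), ψ (∑ i ∈ S, z i)
    ≤ ∑ S ∈ (Finset.powersetCard (m + 1) (Finset.univ : Finset (Fin n))).filter
        (fun S => p ∈ S), ψ (∑ i ∈ S, z i) := by
  let e := (Equiv.swap p q).finsetCongr
  calc _ ≤ ∑ S ∈ (Finset.powersetCard (m + 1) (Finset.univ : Finset (Fin n))).filter
        (fun S => q ∈ S), ψ (∑ i ∈ e S, z i) :=
        Finset.sum_le_sum fun S hS =>
          hψ (sum_le_sum_map_swap hpq.le (Finset.mem_filter.mp hS).2)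
    _ = _ := Finset.sum_equiv e
        (fun S => by simp [e, Finset.mem_powersetCard, Finset.mem_map_equiv])
        (fun _ _ => rfl)
end

section
/- The function φ : ℝ → ℝ defined by φ(r) = r⁴·exp(−1/r²) for r < 0 and φ(r) = 0 for r ≥ 0 satisfies: (i) φ'(r) ≤ 0 for all r ∈ ℝ, with φ'(r) = 0 if and only if r ≥ 0; and (ii) φ(r) − r·φ'(r) ≤ 0 for all r ∈ ℝ, with φ(r) − r·φ'(r) = 0 if and only if r ≥ 0. -/
/-- The profile function `φ(r) = r⁴ e^{-1/r²}` for `r < 0`, `φ(r) = 0` for `r ≥ 0`. -/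
noncomputable def phi (r : ℝ) : ℝ := if r < 0 then r ^ 4 * Real.exp (-(1 / r ^ 2)) else 0

theorem phi_of_nonneg {r : ℝ} (hr : 0 ≤ r) : phi r = 0 := if_neg hr.not_gt

theorem phi_of_neg {r : ℝ} (hr : r < 0) : phi r = r ^ 4 * Real.exp (-(1 / r ^ 2)) := if_pos hr

theorem norm_phi_le (r : ℝ) : ‖phi r‖ ≤ r ^ 4 := by
  rcases lt_or_ge r 0 with hr | hr
  · rw [phi_of_neg hr, Real.norm_of_nonneg (by positivity)]
    exact mul_le_of_le_one_right (by positivity)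
      (Real.exp_le_one_iff.2 (neg_nonpos.2 (by positivity)))
  · rw [phi_of_nonneg hr, norm_zero]
    positivity

theorem hasDerivAt_phi_zero : HasDerivAt phi 0 0 := by
  have h : phi =O[nhds 0] fun r : ℝ => ‖r - 0‖ ^ 4 :=
    Asymptotics.IsBigO.of_norm_le fun r => by
      simpa [(by decide : Even 4).pow_abs] using norm_phi_le r
  simpa using (h.hasFDerivAt (by norm_num)).hasDerivAt

theorem hasDerivAt_phi_of_neg {r : ℝ} (hr : r < 0) :
    HasDerivAt phi ((4 * r ^ 3 + 2 * r) * Real.exp (-(1 / r ^ 2))) r := by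
  have hne : r ≠ 0 := hr.ne
  have h := (hasDerivAt_pow 4 r).mul
    (((hasDerivAt_pow 2 r).fun_inv (pow_ne_zero 2 hne)).fun_neg.exp)
  have heq : phi =ᶠ[nhds r] fun x => x ^ 4 * Real.exp (-(x ^ 2)⁻¹) := by
    filter_upwards [Iio_mem_nhds hr] with x hx
    rw [phi_of_neg hx, one_div]
  refine (h.congr_of_eventuallyEq heq).congr_deriv ?_
  rw [one_div]
  field_simp
  push_cast
  ring

theorem deriv_phi_of_neg {r : ℝ} (hr : r < 0) :
    deriv phi r = (4 * r ^ 3 + 2 * r) * Real.exp (-(1 / r ^ 2)) :=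
  (hasDerivAt_phi_of_neg hr).deriv

theorem deriv_phi_of_nonneg {r : ℝ} (hr : 0 ≤ r) : deriv phi r = 0 := by
  rcases hr.eq_or_lt with rfl | hr
  · exact hasDerivAt_phi_zero.deriv
  · have heq : phi =ᶠ[nhds r] fun _ => 0 := by
      filter_upwards [Ioi_mem_nhds hr] with x hx
      exact phi_of_nonneg hx.le
    rw [heq.deriv_eq, deriv_const]

theorem deriv_phi_neg {r : ℝ} (hr : r < 0) : deriv phi r < 0 := by
  rw [deriv_phi_of_neg hr]
  exact mul_neg_of_neg_of_pos (by nlinarith [sq_nonneg r]) (Real.exp_pos _)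

theorem phi_sub_mul_deriv_neg {r : ℝ} (hr : r < 0) : phi r - r * deriv phi r < 0 := by
  have h : phi r - r * deriv phi r =
      -((3 * r ^ 4 + 2 * r ^ 2) * Real.exp (-(1 / r ^ 2))) := by
    rw [deriv_phi_of_neg hr, phi_of_neg hr]
    ring
  have hne : r ≠ 0 := hr.ne
  rw [h, neg_lt_zero]
  positivity

theorem phi_sub_mul_deriv_of_nonneg {r : ℝ} (hr : 0 ≤ r) : phi r - r * deriv phi r = 0 := by
  rw [phi_of_nonneg hr, deriv_phi_of_nonneg hr, mul_zero, sub_zero]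

/-- The profile function `φ` satisfies `φ'(r) ≤ 0` with equality iff
`r ≥ 0`, and `φ(r) - r φ'(r) ≤ 0` with equality iff `r ≥ 0`. -/
theorem stmt_8 :
    (∀ r : ℝ, deriv phi r ≤ 0) ∧
    (∀ r : ℝ, deriv phi r = 0 ↔ 0 ≤ r) ∧
    (∀ r : ℝ, phi r - r * deriv phi r ≤ 0) ∧
    (∀ r : ℝ, phi r - r * deriv phi r = 0 ↔ 0 ≤ r) := by
  refine ⟨fun r => ?_, fun r => ⟨fun h => ?_, deriv_phi_of_nonneg⟩, fun r => ?_,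
    fun r => ⟨fun h => ?_, phi_sub_mul_deriv_of_nonneg⟩⟩
  · exact (lt_or_ge r 0).elim (fun hr => (deriv_phi_neg hr).le)
      fun hr => (deriv_phi_of_nonneg hr).le
  · exact not_lt.1 fun hr => (deriv_phi_neg hr).ne h
  · exact (lt_or_ge r 0).elim (fun hr => (phi_sub_mul_deriv_neg hr).le)
      fun hr => (phi_sub_mul_deriv_of_nonneg hr).le
  · exact not_lt.1 fun hr => (phi_sub_mul_deriv_neg hr).ne h
end

section
/- Let Γ ⊆ ℝⁿ (n ≥ 3) be an open, convex, permutation-invariant cone, let f : Γ → ℝ be smooth, symmetric, convex, positive, homogeneous of degree one, with ∂f/∂zᵢ > 0 on Γ for every i. Fix 0 ≤ m ≤ n−2 and a > 0, and define g : Γ → ℝ by g(z) = f(z)·Σ_S φ((Σ_{i∈S} zᵢ − a·f(z))/f(z)), the sum running over all subsets S ⊆ {1,…,n} with |S| = m+1, where φ(r) = r⁴·exp(−1/r²) for r < 0 and φ(r) = 0 for r ≥ 0. Then for every z ∈ Γ with pairwise distinct entries and every totally symmetric 3-tensor T on {1,…,n}: Σ_{k,p,q} [(∂g/∂z_k)(z)·(∂²f/∂z_p∂z_q)(z)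 − (∂f/∂z_k)(z)·(∂²g/∂z_p∂z_q)(z)]·T_{kpp}·T_{kqq} + 2·Σ_{k} Σ_{p>q} [((∂g/∂z_k)(z)·((∂f/∂z_p)(z) − (∂f/∂z_q)(z)) − (∂f/∂z_k)(z)·((∂g/∂z_p)(z) − (∂g/∂z_q)(z)))/(z_p − z_q)]·(T_{kpq})² ≤ 0. -/
/-- The first derivative of `phi`. -/
noncomputable def phiDeriv (r : ℝ) : ℝ :=
  if r < 0 then (4 * r ^ 3 + 2 * r) * Real.exp (-(1 / r ^ 2)) else 0

/-- The second derivative of `phi`. -/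
noncomputable def phiDeriv₂ (r : ℝ) : ℝ :=
  if r < 0 then (12 * r ^ 2 + 10 + 4 / r ^ 2) * Real.exp (-(1 / r ^ 2)) else 0

lemma exp_neg_one_div_sq_le {r : ℝ} (hr : r ≠ 0) : Real.exp (-(1 / r ^ 2)) ≤ r ^ 2 := by
  have hpos : 0 < r ^ 2 := by positivity
  rw [Real.exp_neg]
  have h := Real.add_one_le_exp (1 / r ^ 2)
  have h' : 1 / r ^ 2 ≤ Real.exp (1 / r ^ 2) := by linarith
  calc (Real.exp (1 / r ^ 2))⁻¹ ≤ (1 / r ^ 2)⁻¹ := inv_anti₀ (by positivity) h'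
    _ = r ^ 2 := by simp

lemma hasDerivAt_exp_neg_one_div_sq {r : ℝ} (hr : r ≠ 0) :
    HasDerivAt (fun x : ℝ => Real.exp (-(1 / x ^ 2)))
      (Real.exp (-(1 / r ^ 2)) * (2 / r ^ 3)) r := by
  have h : HasDerivAt (fun x : ℝ => -(1 / x ^ 2)) (2 / r ^ 3) r := by
    have h2 := ((hasDerivAt_const r (1 : ℝ)).fun_div (hasDerivAt_pow 2 r)
      (by positivity : r ^ 2 ≠ 0)).neg
    refine h2.congr_deriv ?_
    field_simp
    norm_num
    ring
  exact h.exp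

/-- A function that vanishes on `[0, ∞)`, is differentiable on `(-∞, 0)` and is `O(r²)` at the
origin has the expected derivative everywhere. -/
lemma hasDerivAt_ite_neg {u u' : ℝ → ℝ} (hu : ∀ r < 0, HasDerivAt u (u' r) r) {C : ℝ}
    (hC : ∀ r < 0, -1 < r → |u r| ≤ C * r ^ 2) (r : ℝ) :
    HasDerivAt (fun x => if x < 0 then u x else 0) (if r < 0 then u' r else 0) r := by
  rcases lt_trichotomy r 0 with hr | rfl | hr
  · rw [if_pos hr]
    refine (hu r hr).congr_of_eventuallyEq ?_
    filter_upwards [eventually_lt_nhds hr] with x hx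
    simp [hx]
  · have hO : (fun x => if x < 0 then u x else 0) =O[nhds 0] fun x : ℝ => ‖x - 0‖ ^ 2 := by
      refine Asymptotics.IsBigO.of_bound |C| ?_
      filter_upwards [eventually_gt_nhds (show (-1 : ℝ) < 0 by norm_num)] with x hx
      split_ifs with h
      · have h1 := hC x h hx
        have h2 : C * x ^ 2 ≤ |C| * x ^ 2 :=
          mul_le_mul_of_nonneg_right (le_abs_self C) (sq_nonneg x)
        simpa using h1.trans h2
      · simp only [norm_zero]
        positivity
    have h := hO.hasFDerivAt (𝕜 := ℝ) (by norm_num : 1 < 2)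
    rw [if_neg (lt_irrefl _), hasDerivAt_iff_hasFDerivAt]
    refine h.congr_fderiv ?_
    ext
    simp
  · rw [if_neg hr.not_gt]
    refine (hasDerivAt_const r (0 : ℝ)).congr_of_eventuallyEq ?_
    filter_upwards [eventually_gt_nhds hr] with x hx
    simp [hx.not_gt]

lemma hasDerivAt_phi (r : ℝ) : HasDerivAt phi (phiDeriv r) r := by
  refine hasDerivAt_ite_neg (u := fun r => r ^ 4 * Real.exp (-(1 / r ^ 2)))
    (u' := fun r => (4 * r ^ 3 + 2 * r) * Real.exp (-(1 / r ^ 2))) (C := 1) ?_ ?_ r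
  · intro r hr
    refine ((hasDerivAt_pow 4 r).mul (hasDerivAt_exp_neg_one_div_sq hr.ne)).congr_deriv ?_
    have := hr.ne
    field_simp
    norm_num
    ring
  · intro r hr hr1
    have h := exp_neg_one_div_sq_le hr.ne
    have h4 : r ^ 4 ≤ 1 := by
      have : r ^ 2 ≤ 1 := by nlinarith
      nlinarith [sq_nonneg r]
    rw [abs_of_nonneg (by positivity)]
    exact mul_le_mul h4 h (Real.exp_pos _).le zero_le_one

lemma hasDerivAt_phiDeriv (r : ℝ) : HasDerivAt phiDeriv (phiDeriv₂ r) r := by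
  refine hasDerivAt_ite_neg (u := fun r => (4 * r ^ 3 + 2 * r) * Real.exp (-(1 / r ^ 2)))
    (u' := fun r => (12 * r ^ 2 + 10 + 4 / r ^ 2) * Real.exp (-(1 / r ^ 2))) (C := 6) ?_ ?_ r
  · intro r hr
    refine ((((hasDerivAt_pow 3 r).const_mul 4).add ((hasDerivAt_id r).const_mul 2)).mul
      (hasDerivAt_exp_neg_one_div_sq hr.ne)).congr_deriv ?_
    have := hr.ne
    simp only [id, Pi.add_apply]
    field_simp
    norm_num
    ring
  · intro r hr hr1
    have h := exp_neg_one_div_sq_le hr.ne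
    have h4 : |4 * r ^ 3 + 2 * r| ≤ 6 := by
      have h2 : r ^ 2 ≤ 1 := by nlinarith
      rw [abs_le]
      constructor <;> nlinarith [sq_nonneg r]
    rw [abs_mul, Real.abs_exp]
    exact mul_le_mul h4 h (Real.exp_pos _).le (by norm_num)

lemma phiDeriv_nonpos (r : ℝ) : phiDeriv r ≤ 0 := by
  unfold phiDeriv
  split_ifs with h
  · exact mul_nonpos_of_nonpos_of_nonneg (by nlinarith [sq_nonneg r]) (Real.exp_pos _).le
  · exact le_rfl

lemma phiDeriv₂_nonneg (r : ℝ) : 0 ≤ phiDeriv₂ r := by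
  unfold phiDeriv₂
  split_ifs <;> positivity

lemma monotone_phiDeriv : Monotone phiDeriv :=
  monotone_of_hasDerivAt_nonneg hasDerivAt_phiDeriv phiDeriv₂_nonneg

section Derivatives

variable {E : Type*} [NormedAddCommGroup E] [NormedSpace ℝ E]

lemma HasFDerivAt.div_real {f g : E → ℝ} {f' g' : E →L[ℝ] ℝ} {w : E} (hf : HasFDerivAt f f' w)
    (hg : HasFDerivAt g g' w) (h0 : g w ≠ 0) :
    HasFDerivAt (fun x => f x / g x) ((g w)⁻¹ • (f' - (f w / g w) • g')) w := by
  have h := hf.mul ((hasDerivAt_inv h0).comp_hasFDerivAt w hg)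
  simp only [div_eq_mul_inv]
  refine h.congr_fderiv ?_
  ext v
  simp
  field_simp
  ring

lemma hasFDerivAt_div_shift {f : E → ℝ} {f' : E →L[ℝ] ℝ} {w : E} (hf : HasFDerivAt f f' w)
    (h0 : f w ≠ 0) (L : E →L[ℝ] ℝ) (a : ℝ) :
    HasFDerivAt (fun x => (L x - a * f x) / f x) ((f w)⁻¹ • (L - (L w / f w) • f')) w := by
  have h := (L.hasFDerivAt.sub (hf.const_mul a)).div_real hf h0
  refine h.congr_fderiv ?_
  ext v
  simp [h0]
  field_simp
  ring

lemma hasFDerivAt_mul_phi {f : E → ℝ} {f' : E →L[ℝ] ℝ} {w : E} (hf : HasFDerivAt f f' w)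
    (h0 : f w ≠ 0) (L : E →L[ℝ] ℝ) (a : ℝ) :
    HasFDerivAt (fun x => f x * phi ((L x - a * f x) / f x))
      ((phi ((L w - a * f w) / f w) - phiDeriv ((L w - a * f w) / f w) * (L w / f w)) • f'
        + phiDeriv ((L w - a * f w) / f w) • L) w := by
  have h := hf.mul ((hasDerivAt_phi _).comp_hasFDerivAt w (hasFDerivAt_div_shift hf h0 L a))
  refine h.congr_fderiv ?_
  ext v
  simp
  field_simp
  ring

lemma hasFDerivAt_fderiv_mul_phi {f : E → ℝ} {f' D : E →L[ℝ] ℝ} {w v : E}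
    (hf : HasFDerivAt f f' w) (h0 : f w ≠ 0)
    {u : E → ℝ} (hu : HasFDerivAt u D w) (huw : u w = f' v) (L : E →L[ℝ] ℝ) (a : ℝ) :
    HasFDerivAt (fun x => (phi ((L x - a * f x) / f x)
        - phiDeriv ((L x - a * f x) / f x) * (L x / f x)) * u x
        + phiDeriv ((L x - a * f x) / f x) * L v)
      ((phi ((L w - a * f w) / f w) - phiDeriv ((L w - a * f w) / f w) * (L w / f w)) • D
        + (phiDeriv₂ ((L w - a * f w) / f w) / f w * (L v - L w / f w * f' v)) •
          (L - (L w / f w) • f')) w := by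
  have hr := hasFDerivAt_div_shift hf h0 L a
  have h1 := (hasDerivAt_phi _).comp_hasFDerivAt w hr
  have h2 := (hasDerivAt_phiDeriv _).comp_hasFDerivAt w hr
  have h3 := L.hasFDerivAt.div_real hf h0
  have h := ((h1.sub (h2.mul h3)).mul hu).add (h2.mul_const (L v))
  refine h.congr_fderiv ?_
  ext x
  simp [huw]
  field_simp
  ring

lemma ConvexOn.fderiv_sub_le {Γ : Set E} {f : E → ℝ} (hconv : ConvexOn ℝ Γ f) {x y : E}
    (hx : x ∈ Γ) (hy : y ∈ Γ) {f' : E →L[ℝ] ℝ} (hf : HasFDerivAt f f' x) :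
    f' (y - x) ≤ f y - f x := by
  have hline : HasDerivAt (fun t : ℝ => f (x + t • (y - x))) (f' (y - x)) 0 := by
    have hl : HasDerivAt (fun t : ℝ => x + t • (y - x)) (y - x) 0 := by
      simpa using ((hasDerivAt_id (0 : ℝ)).smul_const (y - x)).const_add x
    have hf0 : HasFDerivAt f f' (x + (0 : ℝ) • (y - x)) := by simpa using hf
    exact hf0.comp_hasDerivAt 0 hl
  have ht := (hasDerivAt_iff_tendsto_slope.1 hline).mono_left (nhdsGT_le_nhdsNE 0)
  refine le_of_tendsto ht ?_
  filter_upwards [Ioo_mem_nhdsGT (show (0 : ℝ) < 1 by norm_num)] with t ⟨ht0, ht1⟩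
  have h := hconv.2 hx hy (show 0 ≤ 1 - t by linarith) ht0.le (by ring)
  have he : (1 - t) • x + t • y = x + t • (y - x) := by
    rw [smul_sub, sub_smul, one_smul]; abel
  rw [he, smul_eq_mul, smul_eq_mul] at h
  rw [slope_def_field, sub_zero, div_le_iff₀ ht0]
  simp only [zero_smul, add_zero]
  linarith

lemma ConvexOn.fderiv_fderiv_nonneg {Γ : Set E} {f : E → ℝ} (hΓ : IsOpen Γ)
    (hconv : ConvexOn ℝ Γ f) (hf : DifferentiableOn ℝ f Γ) {x : E} (hx : x ∈ Γ)
    (h2 : DifferentiableAt ℝ (fderiv ℝ f) x) (c : E) :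
    0 ≤ fderiv ℝ (fderiv ℝ f) x c c := by
  have hl : HasDerivAt (fun t : ℝ => x + t • c) c 0 := by
    simpa using ((hasDerivAt_id (0 : ℝ)).smul_const c).const_add x
  have hline : HasDerivAt (fun t : ℝ => fderiv ℝ f (x + t • c) c)
      (fderiv ℝ (fderiv ℝ f) x c c) 0 := by
    have hf0 : HasFDerivAt (fderiv ℝ f) (fderiv ℝ (fderiv ℝ f) x) (x + (0 : ℝ) • c) := by
      simpa using h2.hasFDerivAt
    exact ((ContinuousLinearMap.apply ℝ ℝ c).hasFDerivAt.comp _ hf0).comp_hasDerivAt 0 hl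
  have ht := (hasDerivAt_iff_tendsto_slope.1 hline).mono_left (nhdsGT_le_nhdsNE 0)
  refine ge_of_tendsto ht ?_
  have hmem : ∀ᶠ t in nhds (0 : ℝ), x + t • c ∈ Γ :=
    hl.continuousAt.eventually_mem (hΓ.mem_nhds (by simpa using hx))
  filter_upwards [hmem.filter_mono nhdsWithin_le_nhds, self_mem_nhdsWithin] with t htΓ (ht0 : 0 < t)
  have hd : ∀ y ∈ Γ, HasFDerivAt f (fderiv ℝ f y) y := fun y hy =>
    (hf.differentiableAt (hΓ.mem_nhds hy)).hasFDerivAt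
  have e1 := hconv.fderiv_sub_le hx htΓ (hd x hx)
  have e2 := hconv.fderiv_sub_le htΓ hx (hd _ htΓ)
  rw [add_sub_cancel_left, map_smul, smul_eq_mul] at e1
  rw [sub_add_cancel_left, map_neg, map_smul, smul_eq_mul] at e2
  rw [slope_def_field, sub_zero]
  refine div_nonneg ?_ ht0.le
  simp only [zero_smul, add_zero]
  have : 0 ≤ t * (fderiv ℝ f (x + t • c) c - fderiv ℝ f x c) := by linarith
  exact nonneg_of_mul_nonneg_right this ht0

end Derivatives

section Symmetric

variable {ι : Type*}

lemma comp_swap_eq_add_smul [DecidableEq ι] (z : ι → ℝ) (p q : ι) :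
    (fun i => z (Equiv.swap p q i))
      = z + (z q - z p) • (Pi.single p (1 : ℝ) - Pi.single q 1) := by
  funext i
  by_cases hp : i = p
  · subst hp
    by_cases hq : i = q
    · subst hq; simp
    · simp [hq]
  · by_cases hq : i = q
    · subst hq; simp [hp]
    · simp [Equiv.swap_apply_of_ne_of_ne hp hq, hp, hq]

/-- The partial derivatives of a symmetric convex function are ordered as the arguments. -/
lemma ConvexOn.fderiv_single_sub_mul_nonneg [Fintype ι] [DecidableEq ι] {Γ : Set (ι → ℝ)} {f : (ι → ℝ) → ℝ}
    (hconv : ConvexOn ℝ Γ f)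
    (hperm : ∀ σ : Equiv.Perm ι, ∀ z ∈ Γ, (fun i => z (σ i)) ∈ Γ)
    (hsymm : ∀ σ : Equiv.Perm ι, ∀ z ∈ Γ, f (fun i => z (σ i)) = f z)
    {z : ι → ℝ} (hz : z ∈ Γ) {f' : (ι → ℝ) →L[ℝ] ℝ} (hf : HasFDerivAt f f' z) (p q : ι) :
    0 ≤ (f' (Pi.single p 1) - f' (Pi.single q 1)) * (z p - z q) := by
  have h := hconv.fderiv_sub_le hz (hperm (Equiv.swap p q) z hz) hf
  rw [hsymm _ z hz, sub_self, comp_swap_eq_add_smul, add_sub_cancel_left, map_smul, map_sub,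
    smul_eq_mul] at h
  linarith

/-- The sum of the coordinates indexed by `S`, as a continuous linear functional. -/
noncomputable def coordSum (S : Finset ι) : (ι → ℝ) →L[ℝ] ℝ :=
  ∑ i ∈ S, ContinuousLinearMap.proj i

lemma coordSum_apply (S : Finset ι) (w : ι → ℝ) : coordSum S w = ∑ i ∈ S, w i := by
  simp [coordSum]

lemma coordSum_single_nonneg [DecidableEq ι] (S : Finset ι) (p : ι) : 0 ≤ coordSum S (Pi.single p 1) := by
  rw [coordSum_apply]
  exact Finset.sum_nonneg fun i _ => by
    by_cases h : i = p
    · subst h; simp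
    · simp [h]

lemma coordSum_map (S : Finset ι) (σ : Equiv.Perm ι) (w : ι → ℝ) :
    coordSum (S.map σ.toEmbedding) w = coordSum S (fun i => w (σ i)) := by
  simp [coordSum_apply]

lemma sum_powersetCard_coordSum_mul_nonneg [Fintype ι] [DecidableEq ι] {β : ℝ → ℝ}
    (hβ : Monotone β) (j : ℕ) (z : ι → ℝ) (p q : ι) :
    0 ≤ (∑ S ∈ Finset.powersetCard j (Finset.univ : Finset ι),
        β (coordSum S z) * coordSum S (Pi.single p 1)
      - ∑ S ∈ Finset.powersetCard j (Finset.univ : Finset ι),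
        β (coordSum S z) * coordSum S (Pi.single q 1)) * (z p - z q) := by
  set P := Finset.powersetCard j (Finset.univ : Finset ι)
  let τ := Equiv.swap p q
  let d : Finset ι → ℝ := fun S => coordSum S (Pi.single p 1) - coordSum S (Pi.single q 1)
  have hτ (S : Finset ι) (w : ι → ℝ) :
      coordSum (S.map τ.toEmbedding) w = coordSum S w + (w q - w p) * d S := by
    rw [coordSum_map, comp_swap_eq_add_smul]
    simp [d]
  have hd (S : Finset ι) : d (S.map τ.toEmbedding) = -d S := by
    by_cases hpq : p = q
    · subst hpq; simp [d]
    · simp only [d, hτ]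
      simp [hpq, Ne.symm hpq]
  have hre : ∑ S ∈ P, β (coordSum S z) * d S
      = ∑ S ∈ P, β (coordSum (S.map τ.toEmbedding) z) * d (S.map τ.toEmbedding) := by
    refine (Finset.sum_bij' (fun S _ => S.map τ.toEmbedding) (fun S _ => S.map τ.toEmbedding)
      ?_ ?_ ?_ ?_ ?_).symm
    · intro S hS
      simpa [P, Finset.mem_powersetCard] using hS
    · intro S hS
      simpa [P, Finset.mem_powersetCard] using hS
    · intro S _
      ext i
      simp [τ]
    · intro S _
      ext i
      simp [τ]
    · intro S _
      rfl
  have hsum : 2 * ((∑ S ∈ P, β (coordSum S z) * d S) * (z p - z q))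
      = ∑ S ∈ P, (β (coordSum S z) - β (coordSum (S.map τ.toEmbedding) z))
          * (coordSum S z - coordSum (S.map τ.toEmbedding) z) := by
    rw [two_mul]
    nth_rewrite 2 [hre]
    rw [← add_mul, ← Finset.sum_add_distrib, Finset.sum_mul]
    refine Finset.sum_congr rfl fun S _ => ?_
    rw [hd, hτ S z]
    ring
  have hnn : 0 ≤ 2 * ((∑ S ∈ P, β (coordSum S z) * d S) * (z p - z q)) := by
    rw [hsum]
    refine Finset.sum_nonneg fun S _ => ?_
    rcases le_total (coordSum S z) (coordSum (S.map τ.toEmbedding) z) with h | h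
    · exact mul_nonneg_of_nonpos_of_nonpos (sub_nonpos.2 (hβ h)) (sub_nonpos.2 h)
    · exact mul_nonneg (sub_nonneg.2 (hβ h)) (sub_nonneg.2 h)
  rw [← Finset.sum_sub_distrib]
  simp only [← mul_sub]
  change 0 ≤ (∑ S ∈ P, β (coordSum S z) * d S) * (z p - z q)
  linarith

end Symmetric

/-- The gradient term is non-positive once the first and second derivatives of `g` are
`A • Df + B` and `A • D²f + W` with suitable signs on `B` and `W`. -/
lemma gradient_term_nonpos {n : ℕ} {F G B z : Fin n → ℝ} {H K W : Fin n → Fin n → ℝ} {A : ℝ}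
    (hG : ∀ k, G k = A * F k + B k) (hK : ∀ p q, K p q = A * H p q + W p q)
    (hF : ∀ k, 0 ≤ F k) (hB : ∀ k, B k ≤ 0)
    (hH : ∀ c : Fin n → ℝ, 0 ≤ ∑ p, ∑ q, H p q * c p * c q)
    (hW : ∀ c : Fin n → ℝ, 0 ≤ ∑ p, ∑ q, W p q * c p * c q)
    (hFz : ∀ p q, 0 ≤ (F p - F q) * (z p - z q)) (hBz : ∀ p q, 0 ≤ (B p - B q) * (z p - z q))
    (T : Fin n → Fin n → Fin n → ℝ) :
    (∑ k, ∑ p, ∑ q, (G k * H p q - F k * K p q) * T k p p * T k q q)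
      + 2 * ∑ k, ∑ p, ∑ q ∈ Finset.univ.filter (fun q => q < p),
          ((G k * (F p - F q) - F k * (G p - G q)) / (z p - z q)) * (T k p q) ^ 2 ≤ 0 := by
  have h1 : ∀ k, ∑ p, ∑ q, (G k * H p q - F k * K p q) * T k p p * T k q q ≤ 0 := by
    intro k
    have he : ∑ p, ∑ q, (G k * H p q - F k * K p q) * T k p p * T k q q
        = B k * (∑ p, ∑ q, H p q * T k p p * T k q q)
          - F k * ∑ p, ∑ q, W p q * T k p p * T k q q := by
      simp only [Finset.mul_sum, ← Finset.sum_sub_distrib]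
      refine Finset.sum_congr rfl fun p _ => Finset.sum_congr rfl fun q _ => ?_
      rw [hG, hK]
      ring
    rw [he]
    have := mul_nonpos_of_nonpos_of_nonneg (hB k) (hH fun p => T k p p)
    have := mul_nonneg (hF k) (hW fun p => T k p p)
    linarith
  have h2 : ∀ k p q,
      ((G k * (F p - F q) - F k * (G p - G q)) / (z p - z q)) * (T k p q) ^ 2 ≤ 0 := by
    intro k p q
    refine mul_nonpos_of_nonpos_of_nonneg ?_ (sq_nonneg _)
    have hdiv : ∀ x : ℝ, 0 ≤ x * (z p - z q) → 0 ≤ x / (z p - z q) := by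
      intro x hx
      rw [mul_nonneg_iff] at hx
      exact div_nonneg_iff.2 hx
    have he : (G k * (F p - F q) - F k * (G p - G q)) / (z p - z q)
        = B k * ((F p - F q) / (z p - z q)) - F k * ((B p - B q) / (z p - z q)) := by
      rw [hG, hG, hG]
      ring
    rw [he]
    have := mul_nonpos_of_nonpos_of_nonneg (hB k) (hdiv _ (hFz p q))
    have := mul_nonneg (hF k) (hdiv _ (hBz p q))
    linarith
  have s1 := Finset.sum_nonpos fun k (_ : k ∈ Finset.univ) => h1 k
  have s2 := Finset.sum_nonpos fun k (_ : k ∈ Finset.univ) =>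
    Finset.sum_nonpos fun p (_ : p ∈ Finset.univ) =>
      Finset.sum_nonpos fun q (_ : q ∈ Finset.univ.filter (fun q => q < p)) => h2 k p q
  linarith

/-- Lemma 3.1: non-positivity of the gradient term for the preliminary
pinching function.  With `f` smooth, symmetric, convex, positive, degree-one homogeneous
and monotone on an open convex permutation-invariant cone `Γ ⊆ ℝⁿ` (`n ≥ 3`), and
`g(z) = f(z) Σ_S φ((Σ_{i∈S} zᵢ - a f(z))/f(z))` (sum over `(m+1)`-element subsets `S`),
the scalar form of the gradient term `(Ġ F̈ - Ḟ G̈)(T,T)` at any `z ∈ Γ` with pairwise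
distinct entries is non-positive for every totally symmetric 3-tensor `T`. -/
theorem stmt_9 (n : ℕ) (hn : 3 ≤ n)
    (Γ : Set (Fin n → ℝ))
    (hΓopen : IsOpen Γ)
    (hΓconv : Convex ℝ Γ)
    (hΓperm : ∀ σ : Equiv.Perm (Fin n), ∀ z ∈ Γ, (fun i => z (σ i)) ∈ Γ)
    (hΓcone : ∀ z ∈ Γ, ∀ s : ℝ, 0 < s → s • z ∈ Γ)
    (f : (Fin n → ℝ) → ℝ)
    (hf : ContDiffOn ℝ (⊤ : ℕ∞) f Γ)
    (hfsymm : ∀ σ : Equiv.Perm (Fin n), ∀ z ∈ Γ, f (fun i => z (σ i)) = f z)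
    (hfconv : ConvexOn ℝ Γ f)
    (hfpos : ∀ z ∈ Γ, 0 < f z)
    (hfhom : ∀ z ∈ Γ, ∀ s : ℝ, 0 < s → f (s • z) = s * f z)
    (hfmono : ∀ z ∈ Γ, ∀ i : Fin n, 0 < fderiv ℝ f z (Pi.single i 1))
    (m : ℕ) (hm : m ≤ n - 2) (a : ℝ) (ha : 0 < a)
    (g : (Fin n → ℝ) → ℝ)
    (hgdef : ∀ w, g w = f w *
      ∑ S ∈ Finset.powersetCard (m + 1) (Finset.univ : Finset (Fin n)),
        phi (((∑ i ∈ S, w i) - a * f w) / f w))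
    (z : Fin n → ℝ) (hz : z ∈ Γ) (hzdist : Function.Injective z)
    (T : Fin n → Fin n → Fin n → ℝ)
    (hT1 : ∀ k p q, T k p q = T p k q)
    (hT2 : ∀ k p q, T k p q = T k q p) :
    (∑ k, ∑ p, ∑ q,
        (fderiv ℝ g z (Pi.single k 1) *
            fderiv ℝ (fun w => fderiv ℝ f w (Pi.single p 1)) z (Pi.single q 1)
          - fderiv ℝ f z (Pi.single k 1) *
            fderiv ℝ (fun w => fderiv ℝ g w (Pi.single p 1)) z (Pi.single q 1))
          * T k p p * T k q q)
      + 2 * ∑ k, ∑ p, ∑ q ∈ Finset.univ.filter (fun q => q < p),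
          ((fderiv ℝ g z (Pi.single k 1) *
              (fderiv ℝ f z (Pi.single p 1) - fderiv ℝ f z (Pi.single q 1))
            - fderiv ℝ f z (Pi.single k 1) *
              (fderiv ℝ g z (Pi.single p 1) - fderiv ℝ g z (Pi.single q 1)))
            / (z p - z q)) * (T k p q) ^ 2
    ≤ 0 := by
  let P := Finset.powersetCard (m + 1) (Finset.univ : Finset (Fin n))
  let r : Finset (Fin n) → (Fin n → ℝ) → ℝ := fun S w => (coordSum S w - a * f w) / f w
  let A : Finset (Fin n) → (Fin n → ℝ) → ℝ := fun S w =>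
    phi (r S w) - phiDeriv (r S w) * (coordSum S w / f w)
  let ell : Finset (Fin n) → (Fin n → ℝ) →L[ℝ] ℝ := fun S =>
    coordSum S - (coordSum S z / f z) • fderiv ℝ f z
  have hg : g = fun w => ∑ S ∈ P, f w * phi (r S w) := by
    funext w
    rw [hgdef, Finset.mul_sum]
    simp only [r, P, coordSum_apply]
  have hdiff : DifferentiableOn ℝ f Γ := hf.differentiableOn (by simp)
  have hfd : ∀ w ∈ Γ, HasFDerivAt f (fderiv ℝ f w) w := fun w hw =>
    (hdiff.differentiableAt (hΓopen.mem_nhds hw)).hasFDerivAt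
  have hf2 : DifferentiableAt ℝ (fderiv ℝ f) z := by
    have h : ContDiffOn ℝ 1 (fderiv ℝ f) Γ :=
      hf.fderiv_of_isOpen hΓopen (WithTop.coe_le_coe.2 le_top)
    exact (h.differentiableOn (by simp)).differentiableAt (hΓopen.mem_nhds hz)
  have hH : ∀ p, HasFDerivAt (fun w => fderiv ℝ f w (Pi.single p 1))
      ((fderiv ℝ (fderiv ℝ f) z).flip (Pi.single p 1)) z := fun p => by
    refine (hf2.hasFDerivAt.clm_apply (hasFDerivAt_const (Pi.single p (1 : ℝ)) z)).congr_fderiv ?_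
    ext v
    simp
  have hgd : ∀ w ∈ Γ, ∀ v, fderiv ℝ g w v
      = ∑ S ∈ P, (A S w * fderiv ℝ f w v + phiDeriv (r S w) * coordSum S v) := by
    intro w hw v
    have h := HasFDerivAt.fun_sum (u := P) fun S _ =>
      hasFDerivAt_mul_phi (hfd w hw) (hfpos w hw).ne' (coordSum S) a
    rw [hg, h.fderiv]
    simp [A, r]
  have hgdd : ∀ p q, fderiv ℝ (fun w => fderiv ℝ g w (Pi.single p 1)) z (Pi.single q 1)
      = ∑ S ∈ P, (A S z * fderiv ℝ (fun w => fderiv ℝ f w (Pi.single p 1)) z (Pi.single q 1)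
          + phiDeriv₂ (r S z) / f z * ell S (Pi.single p 1) * ell S (Pi.single q 1)) := by
    intro p q
    have h := HasFDerivAt.fun_sum (u := P) fun S _ =>
      hasFDerivAt_fderiv_mul_phi (hfd z hz) (hfpos z hz).ne' (hH p) rfl (coordSum S) a
    have heq : (fun w => fderiv ℝ g w (Pi.single p 1)) =ᶠ[nhds z] _ :=
      Filter.eventuallyEq_of_mem (hΓopen.mem_nhds hz) fun w hw => hgd w hw (Pi.single p 1)
    rw [(h.congr_of_eventuallyEq heq).fderiv, (hH p).fderiv]
    simp [A, r, ell]
  refine gradient_term_nonpos (A := ∑ S ∈ P, A S z)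
    (F := fun k => fderiv ℝ f z (Pi.single k 1)) (G := fun k => fderiv ℝ g z (Pi.single k 1))
    (H := fun p q => fderiv ℝ (fun w => fderiv ℝ f w (Pi.single p 1)) z (Pi.single q 1))
    (K := fun p q => fderiv ℝ (fun w => fderiv ℝ g w (Pi.single p 1)) z (Pi.single q 1))
    (B := fun k => ∑ S ∈ P, phiDeriv (r S z) * coordSum S (Pi.single k 1))
    (W := fun p q => ∑ S ∈ P,
      phiDeriv₂ (r S z) / f z * ell S (Pi.single p 1) * ell S (Pi.single q 1))
    (fun k => ?_) (fun p q => ?_) (fun k => (hfmono z hz k).le) (fun k => ?_) (fun c => ?_)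
    (fun c => ?_) (fun p q => ?_) (fun p q => ?_) T
  · rw [hgd z hz, Finset.sum_add_distrib, Finset.sum_mul]
  · rw [hgdd, Finset.sum_add_distrib, Finset.sum_mul]
  · exact Finset.sum_nonpos fun S _ =>
      mul_nonpos_of_nonpos_of_nonneg (phiDeriv_nonpos _) (coordSum_single_nonneg S k)
  · have h := hfconv.fderiv_fderiv_nonneg hΓopen hdiff hz hf2 c
    have hc : c = ∑ i, c i • (Pi.single i (1 : ℝ) : Fin n → ℝ) := pi_eq_sum_univ' c
    convert h using 1
    conv_rhs => rw [hc]
    simp only [map_sum, map_smul, sum_apply, smul_apply, smul_eq_mul]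
    refine Finset.sum_congr rfl fun p _ => ?_
    rw [Finset.mul_sum]
    refine Finset.sum_congr rfl fun q _ => ?_
    rw [(hH p).fderiv, ContinuousLinearMap.flip_apply]
    ring
  · have he : ∑ p, ∑ q, (∑ S ∈ P, phiDeriv₂ (r S z) / f z * ell S (Pi.single p 1)
          * ell S (Pi.single q 1)) * c p * c q
        = ∑ S ∈ P, phiDeriv₂ (r S z) / f z * (∑ p, ell S (Pi.single p 1) * c p) ^ 2 := by
      simp only [sq, Finset.mul_sum, Finset.sum_mul]
      rw [Finset.sum_comm (s := P)]
      refine Finset.sum_congr rfl fun p _ => ?_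
      rw [Finset.sum_comm (s := P)]
      refine Finset.sum_congr rfl fun q _ => Finset.sum_congr rfl fun S _ => ?_
      ring
    rw [he]
    exact Finset.sum_nonneg fun S _ =>
      mul_nonneg (div_nonneg (phiDeriv₂_nonneg _) (hfpos z hz).le) (sq_nonneg _)
  · exact hfconv.fderiv_single_sub_mul_nonneg hΓperm hfsymm hz (hfd z hz) p q
  · have hβ : Monotone fun x => phiDeriv ((x - a * f z) / f z) := fun x y hxy =>
      monotone_phiDeriv (div_le_div_of_nonneg_right (by linarith) (hfpos z hz).le)
    exact sum_powersetCard_coordSum_mul_nonneg hβ (m + 1) z p q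
end
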